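/- arXiv:1404.0087 — 3 statements merged into one kernel-verified Lean document; each statement's English description precedes it below -/
import Mathlib

section
/- For every n ∈ ℕ, every timed word w ∈ L(C,n) can be written in the canonical block form (s₀,δ)·w₁·(l₁,δ+1)(s₁,δ+2)·w₂·(l₂,δ+3)…(s_F,δ+N)·w_N·(⋆,δ+N+1) for some δ ∈ ℝ≥0 and N ∈ ℕ, where s₀ = s_I, each l_i ∈ L, each s_i ∈ S, and each w_i = (σ^i_1, δ+2(i−1)+δ^i_1)…(σ^i_{n_i}, δ+2(i−1)+δ^i_{n_i}) for some n_i ∈ ℕ with n₁ = n, symbols σ^i_j ∈ M ∪ {#}, and offsets 0 < δ^i_1 < δ^i_2 < … < δ^i_{n_i} < 1. -/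
open scoped NNRat

noncomputable section

/-! ### Parametric timed automata -/

inductive Cmp : Type
  | lt | le | eq | ge | gt
  deriving DecidableEq

def Cmp.holds : Cmp → ℝ → ℝ → Prop
  | .lt, a, b => a < b
  | .le, a, b => a ≤ b
  | .eq, a, b => a = b
  | .ge, a, b => b ≤ a
  | .gt, a, b => b < a

/-- An atomic clock constraint `x ∼ c` with `c ∈ ℕ ∪ P`. -/
structure ClockAtom (X P : Type) where
  clock : X
  cmp : Cmp
  bound : ℕ ⊕ P

/-- A clock constraint: a conjunction (list) of atomic constraints. -/
abbrev ClockConstraint (X P : Type) := List (ClockAtom X P)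

def ClockAtom.Sat {X P : Type} (ν : X → ℝ) (π : P → ℚ≥0) (c : ClockAtom X P) : Prop :=
  c.cmp.holds (ν c.clock)
    (match c.bound with
      | Sum.inl n => (n : ℝ)
      | Sum.inr p => ((π p : ℚ≥0) : ℝ))

def ClockConstraint.Sat {X P : Type} (ν : X → ℝ) (π : P → ℚ≥0)
    (φ : ClockConstraint X P) : Prop :=
  ∀ c ∈ φ, c.Sat ν π

/-- A parametric timed automaton over alphabet `A`, clocks `X`, parameters `P`,
locations `Loc`. -/
structure PTA (A X P Loc : Type) where
  init : Set Loc
  edges : Set (Loc × A × ClockConstraint X P × Set X × Loc)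
  final : Set Loc

/-- `PTA.Run M π l ν t w`: from global state `(l, ν)` at absolute time `t`, the automaton
can read the (absolutely timestamped) timed word `w` and end in a final location. -/
inductive PTA.Run {A X P Loc : Type} (M : PTA A X P Loc) (π : P → ℚ≥0) :
    Loc → (X → ℝ) → ℝ → List (A × ℝ) → Prop
  | nil (l : Loc) (ν : X → ℝ) (t : ℝ) : l ∈ M.final → PTA.Run M π l ν t []
  | cons {l : Loc} {ν : X → ℝ} {t : ℝ} {a : A} {t' : ℝ} {l' : Loc} {ν' : X → ℝ}
      {w : List (A × ℝ)} (φ : ClockConstraint X P) (lam : Set X) :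
      t ≤ t' →
      (l, a, φ, lam, l') ∈ M.edges →
      ClockConstraint.Sat (fun x => ν x + (t' - t)) π φ →
      (∀ x, (x ∈ lam → ν' x = 0) ∧ (x ∉ lam → ν' x = ν x + (t' - t))) →
      PTA.Run M π l' ν' t' w →
      PTA.Run M π l ν t ((a, t') :: w)

/-- The timed language accepted by `M` under parameter valuation `π`. -/
def PTA.Lang {A X P Loc : Type} (M : PTA A X P Loc) (π : P → ℚ≥0) :
    Set (List (A × ℝ)) :=
  { w | w ≠ [] ∧ ∃ l ∈ M.init, PTA.Run M π l (fun _ => 0) 0 w }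

def PTA.Deterministic {A X P Loc : Type} (M : PTA A X P Loc) : Prop :=
  (∃ l, M.init = {l}) ∧
  ∀ e₁ ∈ M.edges, ∀ e₂ ∈ M.edges, e₁ ≠ e₂ → e₁.1 = e₂.1 → e₁.2.1 = e₂.2.1 →
    ∀ (ν : X → ℝ) (π : P → ℚ≥0),
      ¬ (ClockConstraint.Sat ν π e₁.2.2.1 ∧ ClockConstraint.Sat ν π e₂.2.2.1)

/-- A (finite, nonempty) timed word with non-decreasing, non-negative timestamps. -/
def IsTimedWord {A : Type} (w : List (A × ℝ)) : Prop :=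
  w ≠ [] ∧ (∀ e ∈ w, 0 ≤ e.2) ∧ List.Chain' (fun e f : A × ℝ => e.2 ≤ f.2) w

/-! ### Metric temporal logic -/

/-- An interval of `ℝ≥0` with endpoints in `ℕ ∪ {∞}` (`hi = none` means `∞`). -/
structure MTLInterval where
  lo : ℕ
  hi : Option ℕ
  loStrict : Bool
  hiStrict : Bool

def MTLInterval.Mem (I : MTLInterval) (t : ℝ) : Prop :=
  (if I.loStrict then (I.lo : ℝ) < t else (I.lo : ℝ) ≤ t) ∧
  (match I.hi with
    | none => True
    | some b => if I.hiStrict then t < (b : ℝ) else t ≤ (b : ℝ))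

/-- `[0, ∞)`, i.e. the full time domain `ℝ≥0`. -/
def MTLInterval.full : MTLInterval := ⟨0, none, false, false⟩
/-- `(0, ∞)`. -/
def MTLInterval.pos : MTLInterval := ⟨0, none, true, false⟩
/-- `[n, n] = {n}`. -/
def MTLInterval.exactly (n : ℕ) : MTLInterval := ⟨n, some n, false, false⟩
/-- `[0, n)`, i.e. `< n`. -/
def MTLInterval.ltI (n : ℕ) : MTLInterval := ⟨0, some n, false, true⟩
/-- `(a, b)`. -/
def MTLInterval.ooI (a b : ℕ) : MTLInterval := ⟨a, some b, true, true⟩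
/-- `[a, b)`. -/
def MTLInterval.coI (a b : ℕ) : MTLInterval := ⟨a, some b, false, true⟩

/-- MTL formulae over atomic propositions (alphabet letters) `A`. -/
inductive MTL (A : Type) : Type
  | atom : A → MTL A
  | not : MTL A → MTL A
  | and : MTL A → MTL A → MTL A
  | untl : MTL A → MTL A → MTLInterval → MTL A

/-- Timestamp of the `i`-th event of `w` (junk value `0` out of range). -/
def tstamp {A : Type} (w : List (A × ℝ)) (i : ℕ) : ℝ :=
  ((w[i]?).map Prod.snd).getD 0

/-- The pointwise satisfaction relation for MTL over finite timed words
(positions are 0-based). -/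
def MTL.Sat {A : Type} (w : List (A × ℝ)) : MTL A → ℕ → Prop
  | .atom a, i => (w[i]?).map Prod.fst = some a
  | .not φ, i => ¬ MTL.Sat w φ i
  | .and φ ψ, i => MTL.Sat w φ i ∧ MTL.Sat w ψ i
  | .untl φ ψ I, i => ∃ j, i < j ∧ j < w.length ∧ MTL.Sat w ψ j ∧
      I.Mem (tstamp w j - tstamp w i) ∧ ∀ k, i < k → k < j → MTL.Sat w φ k

namespace MTL
variable {A : Type}
def or (φ ψ : MTL A) : MTL A := .not (.and (.not φ) (.not ψ))
def imp (φ ψ : MTL A) : MTL A := or (.not φ) ψ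
def tt [Inhabited A] : MTL A := or (.atom default) (.not (.atom default))
def ff [Inhabited A] : MTL A := .not tt
def X [Inhabited A] (I : MTLInterval) (φ : MTL A) : MTL A := .untl ff φ I
def F [Inhabited A] (I : MTLInterval) (φ : MTL A) : MTL A := .untl tt φ I
def G [Inhabited A] (I : MTLInterval) (φ : MTL A) : MTL A := .not (F I (.not φ))
def bigOr [Inhabited A] (l : List (MTL A)) : MTL A := l.foldr or ff
def bigAnd [Inhabited A] (l : List (MTL A)) : MTL A := l.foldr .and tt
end MTL

/-! ### Channel machines -/

/-- Labels of a channel machine: `m!` (send), `m?` (receive), or `ε`. -/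
inductive CMLabel (M : Type) : Type
  | send : M → CMLabel M
  | recv : M → CMLabel M
  | eps : CMLabel M
  deriving DecidableEq

/-- A channel machine `C = (S, s_I, M, Δ)`: finite-state automaton acting on an
unbounded fifo channel. -/
structure ChannelMachine (S M : Type) where
  init : S
  trans : Finset (S × CMLabel M × S)

/-- The error-free transition relation `→` on configurations `(s, x)`. -/
inductive CMStep {S M : Type} (C : ChannelMachine S M) :
    S × List M → CMLabel M → S × List M → Prop
  | send {s s' : S} {x : List M} {m : M} :
      (s, CMLabel.send m, s') ∈ C.trans →
      CMStep C (s, x) (CMLabel.send m) (s', x ++ [m])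
  | recv {s s' : S} {x : List M} {m : M} :
      (s, CMLabel.recv m, s') ∈ C.trans →
      CMStep C (s, m :: x) (CMLabel.recv m) (s', x)
  | eps {s s' : S} :
      (s, CMLabel.eps, s') ∈ C.trans →
      CMStep C (s, []) CMLabel.eps (s', [])

/-- The transition relation `⤳` with insertion errors: the source channel content may be a
(scattered) subword of a content on which `→` fires, and the result may be a superword. -/
def CMStepErr {S M : Type} (C : ChannelMachine S M)
    (c : S × List M) (l : CMLabel M) (c' : S × List M) : Prop :=
  ∃ x x', CMStep C (c.1, x) l (c'.1, x') ∧ c.2.Sublist x ∧ x'.Sublist c'.2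

/-- An error-free computation of `C` (a finite sequence of `→`-steps). -/
structure CMComputation {S M : Type} (C : ChannelMachine S M) where
  len : ℕ
  states : ℕ → S
  chans : ℕ → List M
  labels : ℕ → CMLabel M
  steps : ∀ i < len, CMStep C (states i, chans i) (labels i) (states (i + 1), chans (i + 1))

/-- `max(γ)`: the maximum length of the channel content occurring in `γ`. -/
def CMComputation.maxChan {S M : Type} {C : ChannelMachine S M} (γ : CMComputation C) : ℕ :=
  (Finset.range (γ.len + 1)).sup fun i => (γ.chans i).length

/-- `γ` is a computation from `(s_I, ε)` to `(s_F, x)` for some `x ∈ M*`. -/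
def CMComputation.FromTo {S M : Type} {C : ChannelMachine S M}
    (γ : CMComputation C) (sF : S) : Prop :=
  γ.states 0 = C.init ∧ γ.chans 0 = [] ∧ γ.states γ.len = sF

/-! ### The alphabet `Σ = S ∪ M ∪ L ∪ {#, ⋆}` and the encoding languages `L(C, n)` -/

inductive CMSym (S M : Type) : Type
  | state : S → CMSym S M
  | msg : M → CMSym S M
  | lab : CMLabel M → CMSym S M
  | hash : CMSym S M
  | star : CMSym S M

instance {S M : Type} : Inhabited (CMSym S M) := ⟨CMSym.hash⟩

/-- Channel-content symbols: elements of `M ∪ {#}`. -/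
def CMSym.isContent {S M : Type} : CMSym S M → Prop
  | .msg _ => True
  | .hash => True
  | _ => False

/-- Symbols of `L ∪ {⋆}`. -/
def CMSym.isLabOrStar {S M : Type} : CMSym S M → Prop
  | .lab _ => True
  | .star => True
  | _ => False

/-- The symbol at position `i` of a timed word. -/
def symAt {S M : Type} (w : List (CMSym S M × ℝ)) (i : ℕ) : Option (CMSym S M) :=
  (w[i]?).map Prod.fst

/-- The timestamp at position `i` of a timed word (junk value `0` out of range). -/
def tAt {S M : Type} (w : List (CMSym S M × ℝ)) (i : ℕ) : ℝ :=
  ((w[i]?).map Prod.snd).getD 0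

/-- Some occurrence of the symbol `σ` at time `t` in `w`. -/
def hasAt {S M : Type} (w : List (CMSym S M × ℝ)) (σ : CMSym S M) (t : ℝ) : Prop :=
  ∃ j, j < w.length ∧ symAt w j = some σ ∧ tAt w j = t

/-- The timestamp of the last content symbol of the block `(a, b)`
(the timestamp of the control state symbol if the block is empty). -/
def blockLastTime {S M : Type} (w : List (CMSym S M × ℝ)) (a b : ℕ) : ℝ :=
  if b = a + 1 then tAt w a else tAt w (b - 1)

/-- The copy/replacement policy on the encoding of channel contents: for every infix
`(s, δ) (σ₁, δ+δ₁) … (σ_m, δ+δ_m) (l, δ+1)` of `w`, the condition determined by the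
label `l` holds. -/
def CopyPolicy {S M : Type} (w : List (CMSym S M × ℝ)) : Prop :=
  ∀ a b s l, symAt w a = some (CMSym.state s) → symAt w b = some (CMSym.lab l) →
    a < b → tAt w b = tAt w a + 1 →
    (match l with
     | CMLabel.eps =>
         -- the channel is empty and every `#` is copied two time units later
         (∀ i, a < i → i < b → symAt w i = some CMSym.hash) ∧
         (∀ i, a < i → i < b → hasAt w CMSym.hash (tAt w i + 2))
     | CMLabel.send m =>
         -- if some `#` occurs in the block, the first one is replaced by `m`
         -- two time units later, all other symbols are copied
         ((∃ j, a < j ∧ j < b ∧ symAt w j = some CMSym.hash) →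
            ∃ j, a < j ∧ j < b ∧ symAt w j = some CMSym.hash ∧
              (∀ i, a < i → i < j → ¬ symAt w i = some CMSym.hash) ∧
              hasAt w (CMSym.msg m) (tAt w j + 2) ∧
              (∀ i σ, a < i → i < b → i ≠ j → symAt w i = some σ →
                hasAt w σ (tAt w i + 2))) ∧
         -- otherwise all symbols are copied and a new `m` is inserted at the end
         -- of the encoding of the next configuration
         ((∀ j, a < j → j < b → ¬ symAt w j = some CMSym.hash) →
            (∀ i σ, a < i → i < b → symAt w i = some σ → hasAt w σ (tAt w i + 2)) ∧
            (∃ k, k < w.length ∧ symAt w k = some (CMSym.msg m) ∧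
              blockLastTime w a b + 2 < tAt w k ∧ tAt w k < tAt w a + 3))
     | CMLabel.recv m =>
         -- if the first symbol of the block is `m`, the copies of the remaining symbols
         -- are shifted one position to the right and a new `#` closes the next block
         ((a + 1 < b → symAt w (a + 1) = some (CMSym.msg m) →
            (∀ i σ, a + 1 < i → i < b → symAt w i = some σ →
              hasAt w σ (tAt w (i - 1) + 2)) ∧
            hasAt w CMSym.hash (tAt w (b - 1) + 2)) ∧
         -- otherwise (insertion error) all symbols are copied and a new `#` is inserted
         -- at the end of the encoding of the next configuration
         (¬ (a + 1 < b ∧ symAt w (a + 1) = some (CMSym.msg m)) →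
            (∀ i σ, a < i → i < b → symAt w i = some σ → hasAt w σ (tAt w i + 2)) ∧
            (∃ k, k < w.length ∧ symAt w k = some CMSym.hash ∧
              blockLastTime w a b + 2 < tAt w k ∧ tAt w k < tAt w a + 3))))

/-- The timed language `L(C, n)` of encodings of (possibly faulty) computations of `C`
from `(s_I, ε)` to `(s_F, x)`, where `n` is the expected maximum length of the
channel content. -/
def CMLang {S M : Type} (C : ChannelMachine S M) (sF : S) (n : ℕ) :
    Set (List (CMSym S M × ℝ)) :=
  { w |
    -- `w` is a strictly monotonic timed word
    w ≠ [] ∧ (∀ e ∈ w, 0 ≤ e.2) ∧ List.Chain' (fun e f : CMSym S M × ℝ => e.2 < f.2) w ∧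
    -- every control state symbol `s ≠ s_F` is followed by a label symbol `l` after one
    -- time unit and by a control state symbol `s'` after two time units, with `(s,l,s') ∈ Δ`
    (∀ i s, symAt w i = some (CMSym.state s) → s ≠ sF →
      ∃ l s', (s, l, s') ∈ C.trans ∧
        hasAt w (CMSym.lab l) (tAt w i + 1) ∧ hasAt w (CMSym.state s') (tAt w i + 2)) ∧
    -- `s_F` is followed by `⋆` after one time unit
    (∀ i, symAt w i = some (CMSym.state sF) → hasAt w CMSym.star (tAt w i + 1)) ∧
    -- control state symbols, label symbols and `⋆` do not occur anywhere else
    (∀ i l, symAt w i = some (CMSym.lab l) →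
      ∃ j s, symAt w j = some (CMSym.state s) ∧ s ≠ sF ∧ tAt w i = tAt w j + 1) ∧
    (∀ i, symAt w i = some CMSym.star →
      ∃ j, symAt w j = some (CMSym.state sF) ∧ tAt w i = tAt w j + 1) ∧
    (∀ i, symAt w i = some CMSym.star → i = w.length - 1) ∧
    (∀ i s, symAt w i = some (CMSym.state s) → i ≠ 0 →
      ∃ j s', symAt w j = some (CMSym.state s') ∧ tAt w i = tAt w j + 2) ∧
    -- symbols of `M ∪ {#}` occur only strictly inside the unit interval following
    -- a control state symbol
    (∀ i σ, symAt w i = some σ → σ.isContent →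
      ∃ j s, symAt w j = some (CMSym.state s) ∧ tAt w j < tAt w i ∧ tAt w i < tAt w j + 1) ∧
    -- within a block, `#` occurs only after message symbols
    (∀ i m, ¬ (symAt w i = some CMSym.hash ∧ symAt w (i + 1) = some (CMSym.msg m))) ∧
    -- the untimed prefix of `w` is `s_I #ⁿ l s`
    (∃ l s rest, w.map Prod.fst =
      CMSym.state C.init ::
        (List.replicate n CMSym.hash ++ CMSym.lab l :: CMSym.state s :: rest)) ∧
    -- `w` contains `s_F`
    (∃ i, symAt w i = some (CMSym.state sF)) ∧
    CopyPolicy w }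

/-- `max(w)`: the maximum number of symbols of `M ∪ {#}` occurring in `w` between a
control state symbol and the following symbol of `L ∪ {⋆}`. -/
noncomputable def wordMax {S M : Type} (w : List (CMSym S M × ℝ)) : ℕ :=
  sSup { k | ∃ a b, a < b ∧ b < w.length ∧
    (∃ s, symAt w a = some (CMSym.state s)) ∧
    (∃ σ, symAt w b = some σ ∧ σ.isLabOrStar) ∧
    (∀ i, a < i → i < b → ∃ σ, symAt w i = some σ ∧ σ.isContent) ∧
    k = b - a - 1 }

/-- The canonical block form
`(s₀,δ) · w₁ · (l₁,δ+1) (s₁,δ+2) · w₂ · (l₂,δ+3) … (s_F, …) · w_N · (⋆, …)`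
of a timed word (blocks are numbered `0, …, N-1` here). -/
structure BlockForm {S M : Type} (C : ChannelMachine S M) (sF : S)
    (w : List (CMSym S M × ℝ)) where
  N : ℕ
  Npos : 0 < N
  δ : ℝ
  δnonneg : 0 ≤ δ
  states : ℕ → S
  labs : ℕ → CMLabel M
  nsz : ℕ → ℕ
  syms : ℕ → ℕ → CMSym S M
  offs : ℕ → ℕ → ℝ
  start : states 0 = C.init
  last : states (N - 1) = sF
  offs_pos : ∀ i < N, ∀ j < nsz i, 0 < offs i j
  offs_lt_one : ∀ i < N, ∀ j < nsz i, offs i j < 1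
  offs_mono : ∀ i < N, ∀ j k, j < k → k < nsz i → offs i j < offs i k
  syms_content : ∀ i < N, ∀ j < nsz i, (syms i j).isContent
  eq : w = ((List.range N).map fun i =>
      (CMSym.state (states i), δ + 2 * (i : ℝ)) ::
        (((List.range (nsz i)).map fun j => (syms i j, δ + 2 * (i : ℝ) + offs i j)) ++
          [(if i = N - 1 then CMSym.star else CMSym.lab (labs i), δ + 2 * (i : ℝ) + 1)])).flatten

/-! ### The parametric timed automaton `A_C` -/

/-- The clock constraint `x = p`. -/
def guardEqP : ClockConstraint Unit Unit := [⟨(), Cmp.eq, Sum.inr ()⟩]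

/-- The deterministic one-clock one-parameter automaton `A_C` excluding insertion errors. -/
def AC {S M : Type} (C : ChannelMachine S M) (sF : S) :
    PTA (CMSym S M) Unit Unit (Fin 5) where
  init := {0}
  final := {4}
  edges := { e |
    e = (0, CMSym.state C.init, ([] : ClockConstraint Unit Unit), Set.univ, 1) ∨
    e = (1, CMSym.hash, guardEqP, Set.univ, 1) ∨
    (∃ l : CMLabel M, e = (1, CMSym.lab l, guardEqP, (∅ : Set Unit), 2)) ∨
    (∃ a : CMSym S M, a ≠ CMSym.state sF ∧
      e = (2, a, ([] : ClockConstraint Unit Unit), (∅ : Set Unit), 2)) ∨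
    e = (2, CMSym.state sF, ([] : ClockConstraint Unit Unit), Set.univ, 3) ∨
    (∃ σ : CMSym S M, σ.isContent ∧ e = (3, σ, guardEqP, Set.univ, 3)) ∨
    e = (3, CMSym.star, guardEqP, (∅ : Set Unit), 4) }

/-! ### The MTL formula `φ_C` -/

def allLabels (M : Type) [Fintype M] : List (CMLabel M) :=
  CMLabel.eps ::
    ((Finset.univ : Finset M).toList.map CMLabel.send ++
     (Finset.univ : Finset M).toList.map CMLabel.recv)

/-- `⋁ S`. -/
def orStates (S M : Type) [Fintype S] : MTL (CMSym S M) :=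
  MTL.bigOr ((Finset.univ : Finset S).toList.map fun s => MTL.atom (CMSym.state s))

/-- `⋁ M`. -/
def orMsgs (S M : Type) [Fintype M] : MTL (CMSym S M) :=
  MTL.bigOr ((Finset.univ : Finset M).toList.map fun m => MTL.atom (CMSym.msg m))

/-- `⋁ L`. -/
def orLabs (S M : Type) [Fintype M] : MTL (CMSym S M) :=
  MTL.bigOr ((allLabels M).map fun l => MTL.atom (CMSym.lab l))

/-- `φ_copyM = G_{(0,1)} ⋀_{m ∈ M} (m → F_{=2} m)`. -/
def phiCopyM (S M : Type) [Fintype M] : MTL (CMSym S M) :=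
  MTL.G (MTLInterval.ooI 0 1)
    (MTL.bigAnd ((Finset.univ : Finset M).toList.map fun m =>
      MTL.imp (MTL.atom (CMSym.msg m)) (MTL.F (MTLInterval.exactly 2) (MTL.atom (CMSym.msg m)))))

/-- `φ_copy# = G_{(0,1)} (# → F_{=2} #)`. -/
def phiCopyHash (S M : Type) : MTL (CMSym S M) :=
  MTL.G (MTLInterval.ooI 0 1)
    (MTL.imp (MTL.atom CMSym.hash) (MTL.F (MTLInterval.exactly 2) (MTL.atom CMSym.hash)))

/-- `G (X_{>0} ⊤ ∨ ¬ X ⊤)` (strict monotonicity). -/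
def phiMono (S M : Type) : MTL (CMSym S M) :=
  MTL.G MTLInterval.full
    (MTL.or (MTL.X MTLInterval.pos MTL.tt) (MTL.not (MTL.X MTLInterval.full MTL.tt)))

/-- `G [⋀_{s ≠ s_F} (s → ⋁_{(s,l,s') ∈ Δ} (F_{=1} l ∧ F_{=2} s')) ∧ (s_F → F_{=1} ⋆)]`. -/
def phiStates {S M : Type} [Fintype S] [DecidableEq S]
    (C : ChannelMachine S M) (sF : S) : MTL (CMSym S M) :=
  MTL.G MTLInterval.full
    (MTL.and
      (MTL.bigAnd (((Finset.univ : Finset S).toList.filter fun s => decide (s ≠ sF)).map fun s =>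
        MTL.imp (MTL.atom (CMSym.state s))
          (MTL.bigOr (C.trans.toList.filterMap fun tr =>
            if tr.1 = s then
              some (MTL.and (MTL.F (MTLInterval.exactly 1) (MTL.atom (CMSym.lab tr.2.1)))
                            (MTL.F (MTLInterval.exactly 2) (MTL.atom (CMSym.state tr.2.2))))
            else none))))
      (MTL.imp (MTL.atom (CMSym.state sF)) (MTL.F (MTLInterval.exactly 1) (MTL.atom CMSym.star))))

/-- `G [⋁S → (G_{<2} ¬⋁S ∧ G_{(0,1) ∪ (1,2)} ¬⋁L)]`. -/
def phiPlacement (S M : Type) [Fintype S] [Fintype M] : MTL (CMSym S M) :=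
  MTL.G MTLInterval.full
    (MTL.imp (orStates S M)
      (MTL.and (MTL.G (MTLInterval.ltI 2) (MTL.not (orStates S M)))
        (MTL.and (MTL.G (MTLInterval.ooI 0 1) (MTL.not (orLabs S M)))
                 (MTL.G (MTLInterval.ooI 1 2) (MTL.not (orLabs S M))))))

/-- `G [⋁S → (G_{(0,1)} (⋁M ∨ #) ∧ G_{[1,2)} ¬(⋁M ∨ #))]`. -/
def phiContent (S M : Type) [Fintype S] [Fintype M] : MTL (CMSym S M) :=
  MTL.G MTLInterval.full
    (MTL.imp (orStates S M)
      (MTL.and (MTL.G (MTLInterval.ooI 0 1) (MTL.or (orMsgs S M) (MTL.atom CMSym.hash)))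
        (MTL.G (MTLInterval.coI 1 2) (MTL.not (MTL.or (orMsgs S M) (MTL.atom CMSym.hash))))))

/-- `G ((# ∧ X ⋁M) → ⊥)`. -/
def phiHashMsg (S M : Type) [Fintype M] : MTL (CMSym S M) :=
  MTL.G MTLInterval.full
    (MTL.imp (MTL.and (MTL.atom CMSym.hash) (MTL.X MTLInterval.full (orMsgs S M))) MTL.ff)

/-- `s_I ∧ ⋁_{(s_I,l,s) ∈ Δ} (# U (l ∧ X s))`. -/
def phiInit {S M : Type} [DecidableEq S] (C : ChannelMachine S M) : MTL (CMSym S M) :=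
  MTL.and (MTL.atom (CMSym.state C.init))
    (MTL.bigOr (C.trans.toList.filterMap fun tr =>
      if tr.1 = C.init then
        some (MTL.untl (MTL.atom CMSym.hash)
          (MTL.and (MTL.atom (CMSym.lab tr.2.1))
            (MTL.X MTLInterval.full (MTL.atom (CMSym.state tr.2.2))))
          MTLInterval.full)
      else none))

/-- `G ⋀_{(s,ε,·) ∈ Δ, s ≠ s_F} ((s ∧ F_{=1} ε) → (G_{(0,1)} ¬⋁M ∧ φ_copy#))`. -/
def phiEps {S M : Type} [Fintype M] [DecidableEq S]
    (C : ChannelMachine S M) (sF : S) : MTL (CMSym S M) :=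
  MTL.G MTLInterval.full
    (MTL.bigAnd (C.trans.toList.filterMap fun tr =>
      match tr with
      | (s, CMLabel.eps, _) =>
        if s = sF then none else
          some (MTL.imp (MTL.and (MTL.atom (CMSym.state s))
              (MTL.F (MTLInterval.exactly 1) (MTL.atom (CMSym.lab CMLabel.eps))))
            (MTL.and (MTL.G (MTLInterval.ooI 0 1) (MTL.not (orMsgs S M))) (phiCopyHash S M)))
      | _ => none))

/-- `φ_next# = X# → (X F_{=2} m ∧ X φ_copy#)`. -/
def phiNextHash (S M : Type) (m : M) : MTL (CMSym S M) :=
  MTL.imp (MTL.X MTLInterval.full (MTL.atom CMSym.hash))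
    (MTL.and (MTL.X MTLInterval.full (MTL.F (MTLInterval.exactly 2) (MTL.atom (CMSym.msg m))))
             (MTL.X MTLInterval.full (phiCopyHash S M)))

/-- `φ_yes# = (F_{<1}# ∧ ¬X#) → G_{<1} ((¬# ∧ X#) → (X F_{=2} m ∧ X φ_copy#))`. -/
def phiYesHash (S M : Type) (m : M) : MTL (CMSym S M) :=
  MTL.imp (MTL.and (MTL.F (MTLInterval.ltI 1) (MTL.atom CMSym.hash))
                   (MTL.not (MTL.X MTLInterval.full (MTL.atom CMSym.hash))))
    (MTL.G (MTLInterval.ltI 1)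
      (MTL.imp (MTL.and (MTL.not (MTL.atom CMSym.hash))
                        (MTL.X MTLInterval.full (MTL.atom CMSym.hash)))
        (MTL.and (MTL.X MTLInterval.full (MTL.F (MTLInterval.exactly 2) (MTL.atom (CMSym.msg m))))
                 (MTL.X MTLInterval.full (phiCopyHash S M)))))

/-- `φ_no# = ¬F_{<1}# → G_{<1} (X m! → F_{=2} (X m ∧ X X ⋁L))`. -/
def phiNoHash (S M : Type) [Fintype M] (m : M) : MTL (CMSym S M) :=
  MTL.imp (MTL.not (MTL.F (MTLInterval.ltI 1) (MTL.atom CMSym.hash)))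
    (MTL.G (MTLInterval.ltI 1)
      (MTL.imp (MTL.X MTLInterval.full (MTL.atom (CMSym.lab (CMLabel.send m))))
        (MTL.F (MTLInterval.exactly 2)
          (MTL.and (MTL.X MTLInterval.full (MTL.atom (CMSym.msg m)))
                   (MTL.X MTLInterval.full (MTL.X MTLInterval.full (orLabs S M)))))))

/-- `G ⋀_{(s,m!,·) ∈ Δ, s ≠ s_F} ((s ∧ F_{=1} m!) → (φ_copyM ∧ φ_next# ∧ φ_yes# ∧ φ_no#))`. -/
def phiSend {S M : Type} [Fintype M] [DecidableEq S]
    (C : ChannelMachine S M) (sF : S) : MTL (CMSym S M) :=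
  MTL.G MTLInterval.full
    (MTL.bigAnd (C.trans.toList.filterMap fun tr =>
      match tr with
      | (s, CMLabel.send m, _) =>
        if s = sF then none else
          some (MTL.imp (MTL.and (MTL.atom (CMSym.state s))
              (MTL.F (MTLInterval.exactly 1) (MTL.atom (CMSym.lab (CMLabel.send m)))))
            (MTL.and (phiCopyM S M)
              (MTL.and (phiNextHash S M m) (MTL.and (phiYesHash S M m) (phiNoHash S M m)))))
      | _ => none))

/-- `φ_shift = ⋀_{m' ∈ M} (X m' → F_{=2} m') ∧ (X# → F_{=2}#) ∧ (X m? → F_{=2}#)`. -/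
def phiShift (S M : Type) [Fintype M] (m : M) : MTL (CMSym S M) :=
  MTL.and
    (MTL.bigAnd ((Finset.univ : Finset M).toList.map fun m' =>
      MTL.imp (MTL.X MTLInterval.full (MTL.atom (CMSym.msg m')))
              (MTL.F (MTLInterval.exactly 2) (MTL.atom (CMSym.msg m')))))
    (MTL.and
      (MTL.imp (MTL.X MTLInterval.full (MTL.atom CMSym.hash))
               (MTL.F (MTLInterval.exactly 2) (MTL.atom CMSym.hash)))
      (MTL.imp (MTL.X MTLInterval.full (MTL.atom (CMSym.lab (CMLabel.recv m))))
               (MTL.F (MTLInterval.exactly 2) (MTL.atom CMSym.hash))))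

/-- `φ_yesm = X m → (φ_shift U m?)`. -/
def phiYesM (S M : Type) [Fintype M] (m : M) : MTL (CMSym S M) :=
  MTL.imp (MTL.X MTLInterval.full (MTL.atom (CMSym.msg m)))
    (MTL.untl (phiShift S M m) (MTL.atom (CMSym.lab (CMLabel.recv m))) MTLInterval.full)

/-- `φ_nom = X ¬m → (φ_copyM ∧ φ_copy# ∧ G_{<1} (X m? → F_{=2} (X# ∧ X X ⋁L)))`. -/
def phiNoM (S M : Type) [Fintype M] (m : M) : MTL (CMSym S M) :=
  MTL.imp (MTL.X MTLInterval.full (MTL.not (MTL.atom (CMSym.msg m))))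
    (MTL.and (phiCopyM S M) (MTL.and (phiCopyHash S M)
      (MTL.G (MTLInterval.ltI 1)
        (MTL.imp (MTL.X MTLInterval.full (MTL.atom (CMSym.lab (CMLabel.recv m))))
          (MTL.F (MTLInterval.exactly 2)
            (MTL.and (MTL.X MTLInterval.full (MTL.atom CMSym.hash))
                     (MTL.X MTLInterval.full (MTL.X MTLInterval.full (orLabs S M)))))))))

/-- `G ⋀_{(s,m?,·) ∈ Δ, s ≠ s_F} ((s ∧ F_{=1} m?) → (φ_yesm ∧ φ_nom))`. -/
def phiRecv {S M : Type} [Fintype M] [DecidableEq S]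
    (C : ChannelMachine S M) (sF : S) : MTL (CMSym S M) :=
  MTL.G MTLInterval.full
    (MTL.bigAnd (C.trans.toList.filterMap fun tr =>
      match tr with
      | (s, CMLabel.recv m, _) =>
        if s = sF then none else
          some (MTL.imp (MTL.and (MTL.atom (CMSym.state s))
              (MTL.F (MTLInterval.exactly 1) (MTL.atom (CMSym.lab (CMLabel.recv m)))))
            (MTL.and (phiYesM S M m) (phiNoM S M m)))
      | _ => none))

/-- The MTL formula `φ_C` with `L(φ_C) = L(C)`. -/
def phiC {S M : Type} [Fintype S] [DecidableEq S] [Fintype M] [DecidableEq M]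
    (C : ChannelMachine S M) (sF : S) : MTL (CMSym S M) :=
  MTL.bigAnd
    [phiMono S M, phiStates C sF, phiPlacement S M, phiContent S M, phiHashMsg S M,
     phiInit C, MTL.F MTLInterval.full (MTL.atom (CMSym.state sF)),
     phiEps C sF, phiSend C sF, phiRecv C sF]

theorem symAt_spec {S M : Type} {w : List (CMSym S M × ℝ)} {i : ℕ} {σ : CMSym S M}
    (h : symAt w i = some σ) : ∃ hi : i < w.length, w[i] = (σ, tAt w i) := by
  unfold symAt at h
  by_cases hi : i < w.length
  · refine ⟨hi, ?_⟩
    simp only [List.getElem?_eq_getElem hi, Option.map_some, Option.some.injEq] at h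
    simp [tAt, List.getElem?_eq_getElem hi, ← h]
  · simp [List.getElem?_eq_none (not_lt.mp hi)] at h

theorem getElem_spec {S M : Type} {w : List (CMSym S M × ℝ)} {i : ℕ} (hi : i < w.length) :
    symAt w i = some w[i].1 ∧ tAt w i = w[i].2 := by
  simp [symAt, tAt, List.getElem?_eq_getElem hi]

theorem eq_of_strict_of_mem_iff {A : Type} {l₁ l₂ : List (A × ℝ)}
    (h₁ : l₁.Pairwise (fun e f => e.2 < f.2)) (h₂ : l₂.Pairwise (fun e f => e.2 < f.2))
    (h : ∀ x, x ∈ l₁ ↔ x ∈ l₂) : l₁ = l₂ := by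
  have n₁ : l₁.Nodup := h₁.imp (fun {a b} hab e => by subst e; exact lt_irrefl _ hab)
  have n₂ : l₂.Nodup := h₂.imp (fun {a b} hab e => by subst e; exact lt_irrefl _ hab)
  have hp := (List.perm_ext_iff_of_nodup n₁ n₂).2 h
  exact hp.eq_of_pairwise (fun a b _ _ hab hba => absurd hab (not_lt.2 hba.le)) h₁ h₂

/-- Every `w ∈ L(C, n)` can be written in the canonical block form
`(s₀,δ)·w₁·(l₁,δ+1)(s₁,δ+2)·w₂·(l₂,δ+3)…(s_F,…)·w_N·(⋆,…)` with `s₀ = s_I` and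
`n₁ = n`. -/
theorem CMLang_canonical_block_form
    {S M : Type} [Fintype S] [DecidableEq S] [Fintype M] [DecidableEq M]
    (C : ChannelMachine S M) (sF : S)
    (n : ℕ) (w : List (CMSym S M × ℝ)) (hw : w ∈ CMLang C sF n) :
    ∃ bf : BlockForm C sF w, bf.nsz 0 = n := by
  obtain ⟨hne, hnn, hch, hst, hF, hlab, hstar, hstarlast, hst2, hcont, -, hpre, ⟨iF, hiF⟩, -⟩ := hw
  have hpw : w.Pairwise (fun e f : CMSym S M × ℝ => e.2 < f.2) := by
    haveI : IsTrans (CMSym S M × ℝ) (fun e f => e.2 < f.2) := ⟨fun _ _ _ h h' => lt_trans h h'⟩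
    exact List.isChain_iff_pairwise.1 hch
  have hmono : ∀ i j, i < j → j < w.length → tAt w i < tAt w j := by
    intro i j hij hj
    rw [(getElem_spec hj).2, (getElem_spec (hij.trans hj)).2]
    exact List.pairwise_iff_getElem.1 hpw i j _ _ hij
  have hlt : ∀ i j, i < w.length → tAt w i < tAt w j → i < j := by
    intro i j hi h
    by_contra hc
    rcases (not_lt.1 hc).eq_or_lt with e | e
    · rw [e] at h; exact lt_irrefl _ h
    · exact lt_asymm h (hmono _ _ e hi)
  have hinj : ∀ i j, i < w.length → j < w.length → tAt w i = tAt w j → i = j := by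
    intro i j hi hj h
    rcases lt_trichotomy i j with e | e | e
    · exact absurd h (hmono _ _ e hj).ne
    · exact e
    · exact absurd h (hmono _ _ e hi).ne'
  have hlen : 0 < w.length := List.length_pos_of_ne_nil hne
  set δ := tAt w 0 with hδ
  have hδ0 : 0 ≤ δ := by
    rw [hδ, (getElem_spec hlen).2]; exact hnn _ (List.getElem_mem _)
  have h0 : symAt w 0 = some (CMSym.state C.init) := by
    obtain ⟨l, s, rest, h⟩ := hpre
    have := congrArg (fun L => L[0]?) h
    simpa [symAt] using this
  have hn1 : ∃ l, symAt w (n + 1) = some (CMSym.lab l) := by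
    obtain ⟨l, s, rest, h⟩ := hpre
    refine ⟨l, ?_⟩
    have := congrArg (fun L => L[n+1]?) h
    simpa [symAt] using this
  have hpreh : ∀ i, 0 < i → i ≤ n → symAt w i = some CMSym.hash := by
    obtain ⟨l, s, rest, h⟩ := hpre
    intro i hi hin
    obtain ⟨i, rfl⟩ := Nat.exists_eq_succ_of_ne_zero hi.ne'
    have := congrArg (fun L => L[i+1]?) h
    have hi' : i < n := hin
    simpa [symAt, List.getElem?_append, hi'] using this
  -- control state symbols occur exactly at the even offsets
  have hA : ∀ i s, symAt w i = some (CMSym.state s) → ∃ k : ℕ, tAt w i = δ + 2 * k := by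
    intro i
    induction i using Nat.strong_induction_on with
    | _ i ih =>
      intro s hs
      by_cases hi : i = 0
      · exact ⟨0, by simp [hi, hδ]⟩
      · obtain ⟨j, s', hj, ht⟩ := hst2 i s hs hi
        obtain ⟨k, hk⟩ := ih j (hlt _ _ (symAt_spec hj).1 (by linarith)) s' hj
        exact ⟨k + 1, by push_cast; linarith⟩
  obtain ⟨K, hK⟩ := hA iF sF hiF
  have hdown : ∀ d k, k + d = K → ∃ i s, symAt w i = some (CMSym.state s) ∧
      tAt w i = δ + 2 * (k : ℝ) := by
    intro d
    induction d with
    | zero => intro k hk; exact ⟨iF, sF, hiF, by rw [hK, ← hk]; simp⟩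
    | succ d ih =>
      intro k hk
      obtain ⟨i, s, hi, ht⟩ := ih (k + 1) (by omega)
      push_cast at ht
      have hk0 : (0 : ℝ) ≤ k := Nat.cast_nonneg k
      obtain ⟨j, s', hj, ht'⟩ := hst2 i s hi (by rintro rfl; linarith)
      exact ⟨j, s', hj, by linarith⟩
  obtain ⟨iS, hiSlen, hiS, hiSt⟩ := hF iF hiF
  have hSlast := hstarlast iS hiS
  have hle : ∀ i, i < w.length → tAt w i ≤ δ + 2 * K + 1 := by
    intro i hi
    rw [← hK, ← hiSt]
    rcases (show i ≤ iS by omega).eq_or_lt with e | e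
    · rw [e]
    · exact (hmono _ _ e hiSlen).le
  have hkK : ∀ i k : ℕ, i < w.length → tAt w i = δ + 2 * (k : ℝ) → k ≤ K := by
    intro i k hi h
    have h' : 2 * (k : ℝ) ≤ 2 * K + 1 := by linarith [hle i hi]
    have h'' : 2 * k ≤ 2 * K + 1 := by exact_mod_cast h'
    omega
  have hP : ∀ k, ∃ i s, k ≤ K → symAt w i = some (CMSym.state s) ∧
      tAt w i = δ + 2 * (k : ℝ) := by
    intro k
    by_cases hk : k ≤ K
    · obtain ⟨i, s, h⟩ := hdown (K - k) k (by omega)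
      exact ⟨i, s, fun _ => h⟩
    · exact ⟨0, C.init, fun h => absurd h hk⟩
  choose p st hp using hP
  have hplen : ∀ k, k ≤ K → p k < w.length := fun k hk => (symAt_spec (hp k hk).1).1
  have hsym : ∀ i j σ τ, symAt w i = some σ → symAt w j = some τ → tAt w i = tAt w j →
      σ = τ := by
    intro i j σ τ hi hj h
    have := hinj i j (symAt_spec hi).1 (symAt_spec hj).1 h
    subst this
    rw [hi] at hj; exact Option.some.inj hj
  have hstK : st K = sF := by
    have := hsym _ _ _ _ (hp K le_rfl).1 hiF (by rw [(hp K le_rfl).2, hK])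
    injection this
  have hstk : ∀ k, k < K → st k ≠ sF := by
    intro k hk e
    have h1 := (hp k hk.le)
    rw [e] at h1
    obtain ⟨j, hj, hjs, hjt⟩ := hF _ h1.1
    have := hstarlast j hjs
    have e : j = iS := by omega
    rw [e, hiSt, hK, h1.2] at hjt
    have : (K : ℝ) = k := by linarith
    have : K = k := by exact_mod_cast this
    omega
  have hQ : ∀ k, ∃ q l, k ≤ K → symAt w q = some (if k = K then CMSym.star else CMSym.lab l) ∧
      tAt w q = δ + 2 * (k : ℝ) + 1 := by
    intro k
    by_cases hk : k = K
    · exact ⟨iS, CMLabel.eps, fun _ => ⟨by simpa [hk] using hiS, by rw [hiSt, hK, hk]⟩⟩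
    · by_cases hk' : k ≤ K
      · have hkl : k < K := by omega
        obtain ⟨l, s', -, ⟨j, -, hj, hjt⟩, -⟩ := hst _ _ (hp k hk').1 (hstk k hkl)
        exact ⟨j, l, fun _ => ⟨by simpa [hk] using hj, by rw [hjt, (hp k hk').2]⟩⟩
      · exact ⟨0, CMLabel.eps, fun h => absurd h hk'⟩
  choose q lb hq using hQ
  have hqlen : ∀ k, k ≤ K → q k < w.length := fun k hk => (symAt_spec (hq k hk).1).1
  have hstate_eq : ∀ i s, symAt w i = some (CMSym.state s) → ∃ k, k ≤ K ∧ i = p k ∧ s = st k := by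
    intro i s hi
    obtain ⟨k, hk⟩ := hA i s hi
    have hil := (symAt_spec hi).1
    have hkk := hkK i k hil hk
    have e := hsym _ _ _ _ hi (hp k hkk).1 (by rw [hk, (hp k hkk).2])
    exact ⟨k, hkk, hinj _ _ hil (hplen k hkk) (by rw [hk, (hp k hkk).2]), by injection e⟩
  -- classification of symbols
  have hmid : ∀ k, k ≤ K → ∀ i, p k < i → i < q k → ∃ σ, symAt w i = some σ ∧ σ.isContent := by
    intro k hk i h1 h2
    have hil : i < w.length := h2.trans (hqlen k hk)
    have t1 := hmono _ _ h1 hil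
    have t2 := hmono _ _ h2 (hqlen k hk)
    rw [(hp k hk).2] at t1
    rw [(hq k hk).2] at t2
    have key : ∀ m : ℕ, tAt w i = δ + 2 * (m : ℝ) ∨ tAt w i = δ + 2 * (m : ℝ) + 1 → False := by
      intro m hm
      rcases hm with hm | hm
      · have a1 : (k : ℝ) < m := by linarith
        have a2 : 2 * (m : ℝ) < 2 * k + 1 := by linarith
        have a1' : k < m := by exact_mod_cast a1
        have a2' : 2 * m < 2 * k + 1 := by exact_mod_cast a2
        omega
      · have a1 : 2 * (k : ℝ) < 2 * m + 1 := by linarith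
        have a2 : (m : ℝ) < k := by linarith
        have a1' : 2 * k < 2 * m + 1 := by exact_mod_cast a1
        have a2' : m < k := by exact_mod_cast a2
        omega
    have hs := (getElem_spec hil).1
    refine ⟨_, hs, ?_⟩
    cases hc : w[i].1 with
    | msg m => trivial
    | hash => trivial
    | state s =>
      rw [hc] at hs
      obtain ⟨m, hm⟩ := hA i s hs
      exact (key m (Or.inl hm)).elim
    | lab l =>
      rw [hc] at hs
      obtain ⟨j, s, hj, -, ht⟩ := hlab i l hs
      obtain ⟨m, hm⟩ := hA j s hj
      exact (key m (Or.inr (by rw [ht, hm]))).elim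
    | star =>
      rw [hc] at hs
      obtain ⟨j, hj, ht⟩ := hstar i hs
      obtain ⟨m, hm⟩ := hA j sF hj
      exact (key m (Or.inr (by rw [ht, hm]))).elim
  have hpos : ∀ i, i < w.length → ∃ k, k ≤ K ∧ (i = p k ∨ i = q k ∨ (p k < i ∧ i < q k)) := by
    intro i hil
    have hs := (getElem_spec hil).1
    have hcc : ∀ σ : CMSym S M, symAt w i = some σ → σ.isContent →
        ∃ k, k ≤ K ∧ (i = p k ∨ i = q k ∨ (p k < i ∧ i < q k)) := by
      intro σ h1 h2
      obtain ⟨j, s, hj, t1, t2⟩ := hcont i σ h1 h2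
      obtain ⟨k, hk, e, -⟩ := hstate_eq j s hj
      subst e
      refine ⟨k, hk, Or.inr (Or.inr ⟨hlt _ _ (hplen k hk) t1, hlt _ _ hil ?_⟩)⟩
      rw [(hq k hk).2, ← (hp k hk).2]; exact t2
    cases hc : w[i].1 with
    | msg m => rw [hc] at hs; exact hcc _ hs (by trivial)
    | hash => rw [hc] at hs; exact hcc _ hs (by trivial)
    | state s =>
      rw [hc] at hs
      obtain ⟨k, hk, e, -⟩ := hstate_eq i s hs
      exact ⟨k, hk, Or.inl e⟩
    | lab l =>
      rw [hc] at hs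
      obtain ⟨j, s, hj, -, ht⟩ := hlab i l hs
      obtain ⟨k, hk, e, -⟩ := hstate_eq j s hj
      subst e
      exact ⟨k, hk, Or.inr (Or.inl (hinj _ _ hil (hqlen k hk)
        (by rw [ht, (hq k hk).2, (hp k hk).2])))⟩
    | star =>
      rw [hc] at hs
      obtain ⟨j, hj, ht⟩ := hstar i hs
      obtain ⟨k, hk, e, -⟩ := hstate_eq j sF hj
      subst e
      exact ⟨k, hk, Or.inr (Or.inl (hinj _ _ hil (hqlen k hk)
        (by rw [ht, (hq k hk).2, (hp k hk).2])))⟩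
  have hpq : ∀ k, k ≤ K → p k < q k := fun k hk =>
    hlt _ _ (hplen k hk) (by rw [(hq k hk).2, (hp k hk).2]; linarith)
  have hp0 : p 0 = 0 := hinj _ _ (hplen 0 (Nat.zero_le _)) hlen
    (by rw [(hp 0 (Nat.zero_le _)).2, ← hδ]; simp)
  have hst0 : st 0 = C.init := by
    have := (hp 0 (Nat.zero_le _)).1
    rw [hp0, h0] at this
    injection this with this
    injection this with this
    exact this.symm
  have hq0 : q 0 = n + 1 := by
    obtain ⟨l, hl⟩ := hn1
    have hll := (symAt_spec hl).1
    obtain ⟨j, s, hj, -, ht⟩ := hlab _ l hl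
    have hjl := hlt j (n + 1) (symAt_spec hj).1 (by linarith)
    have hj0 : j = 0 := by
      by_contra hj0
      have := hpreh j (Nat.pos_of_ne_zero hj0) (by omega)
      rw [hj] at this
      cases this
    subst hj0
    refine hinj _ _ (hqlen 0 (Nat.zero_le _)) hll ?_
    rw [(hq 0 (Nat.zero_le _)).2, ht, ← hδ]; simp
  set ns : ℕ → ℕ := fun k => q k - p k - 1 with hns
  set sy : ℕ → ℕ → CMSym S M := fun k j => (symAt w (p k + 1 + j)).getD default with hsy
  set of : ℕ → ℕ → ℝ := fun k j => tAt w (p k + 1 + j) - (δ + 2 * (k : ℝ)) with hof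
  have hidx : ∀ k, k < K + 1 → ∀ j, j < ns k → p k < p k + 1 + j ∧ p k + 1 + j < q k := by
    intro k hk j hj
    simp only [hns] at hj
    omega
  have hofpos : ∀ k < K + 1, ∀ j < ns k, 0 < of k j := by
    intro k hk j hj
    obtain ⟨h1, h2⟩ := hidx k hk j hj
    have hk' : k ≤ K := by omega
    have := hmono _ _ h1 (h2.trans (hqlen k hk'))
    rw [(hp k hk').2] at this
    simp only [hof]; linarith
  have hofone : ∀ k < K + 1, ∀ j < ns k, of k j < 1 := by
    intro k hk j hj
    obtain ⟨h1, h2⟩ := hidx k hk j hj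
    have hk' : k ≤ K := by omega
    have := hmono _ _ h2 (hqlen k hk')
    rw [(hq k hk').2] at this
    simp only [hof]; linarith
  have hofmono : ∀ i < K + 1, ∀ j k, j < k → k < ns i → of i j < of i k := by
    intro i hi j k hjk hk
    obtain ⟨h1, h2⟩ := hidx i hi k hk
    have := hmono (p i + 1 + j) (p i + 1 + k) (by omega) (h2.trans (hqlen i (by omega)))
    simp only [hof]; linarith
  have hsycont : ∀ k < K + 1, ∀ j < ns k, symAt w (p k + 1 + j) = some (sy k j) ∧
      (sy k j).isContent := by
    intro k hk j hj
    obtain ⟨h1, h2⟩ := hidx k hk j hj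
    obtain ⟨σ, h, hc⟩ := hmid k (by omega) _ h1 h2
    have : sy k j = σ := by simp only [hsy]; rw [h]; rfl
    rw [this]; exact ⟨h, hc⟩
  have hmemw : ∀ i σ t, symAt w i = some σ → tAt w i = t → (σ, t) ∈ w := by
    intro i σ t h1 h2
    obtain ⟨hi, e⟩ := symAt_spec h1
    rw [← h2, ← e]; exact List.getElem_mem _
  refine ⟨{ N := K + 1, Npos := Nat.succ_pos _, δ := δ, δnonneg := hδ0, states := st, labs := lb,
            nsz := ns, syms := sy, offs := of, start := hst0, last := hstK,
            offs_pos := hofpos, offs_lt_one := hofone, offs_mono := hofmono,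
            syms_content := fun i hi j hj => (hsycont i hi j hj).2, eq := ?_ }, ?_⟩
  swap
  · simp only [hns]; rw [hq0, hp0]; rfl
  have hblk : ∀ k, k < K + 1 → ∀ x ∈ ((CMSym.state (st k), δ + 2 * (k : ℝ)) ::
        (((List.range (ns k)).map fun j => (sy k j, δ + 2 * (k : ℝ) + of k j)) ++
          [(if k = K + 1 - 1 then CMSym.star else CMSym.lab (lb k), δ + 2 * (k : ℝ) + 1)]) :
          List (CMSym S M × ℝ)),
      x ∈ w ∧ δ + 2 * (k : ℝ) ≤ x.2 ∧ x.2 ≤ δ + 2 * (k : ℝ) + 1 := by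
    intro k hk x hx
    have hk' : k ≤ K := by omega
    simp only [List.mem_cons, List.mem_append, List.mem_map, List.mem_range, List.not_mem_nil,
      or_false, Nat.add_sub_cancel] at hx
    rcases hx with rfl | ⟨j, hj, rfl⟩ | rfl
    · exact ⟨hmemw _ _ _ (hp k hk').1 (hp k hk').2, le_rfl, by simp⟩
    · refine ⟨hmemw _ _ _ (hsycont k hk j hj).1 (by simp only [hof]; ring), ?_, ?_⟩
      · have := hofpos k hk j hj; simp only; linarith
      · have := hofone k hk j hj; simp only; linarith
    · exact ⟨hmemw _ _ _ (hq k hk').1 (hq k hk').2, by simp, le_rfl⟩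
  refine eq_of_strict_of_mem_iff hpw ?_ ?_
  · rw [List.pairwise_flatten]
    constructor
    · intro L hL
      obtain ⟨k, hk, rfl⟩ := List.mem_map.1 hL
      rw [List.mem_range] at hk
      rw [List.pairwise_cons, List.pairwise_append, List.pairwise_map]
      refine ⟨?_, ?_, List.pairwise_singleton _ _, ?_⟩
      · intro x hx
        simp only [List.mem_append, List.mem_map, List.mem_range, List.mem_singleton] at hx
        rcases hx with ⟨j, hj, rfl⟩ | rfl
        · have := hofpos k hk j hj; simp only; linarith
        · simp
      · refine List.Pairwise.imp_of_mem ?_ (List.pairwise_lt_range (n := ns k))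
        intro a b _ hb hab
        have := hofmono k hk a b hab (List.mem_range.1 hb)
        simp only; linarith
      · intro x hx y hy
        obtain ⟨j, hj, rfl⟩ := List.mem_map.1 hx
        rw [List.mem_singleton] at hy
        subst hy
        have := hofone k hk j (List.mem_range.1 hj); simp only; linarith
    · rw [List.pairwise_map]
      refine List.Pairwise.imp_of_mem ?_ (List.pairwise_lt_range (n := K + 1))
      intro a b ha hb hab x hx y hy
      have h1 := (hblk a (List.mem_range.1 ha) x hx).2.2
      have h2 := (hblk b (List.mem_range.1 hb) y hy).2.1
      have h3 : (a : ℝ) + 1 ≤ b := by exact_mod_cast hab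
      linarith
  · intro x
    rw [List.mem_flatten]
    constructor
    · intro hx
      obtain ⟨i, hi, rfl⟩ := List.getElem_of_mem hx
      obtain ⟨k, hk, hcase⟩ := hpos i hi
      refine ⟨_, List.mem_map.2 ⟨k, List.mem_range.2 (by omega), rfl⟩, ?_⟩
      simp only [List.mem_cons, List.mem_append, List.mem_map, List.mem_range, List.not_mem_nil,
        or_false, Nat.add_sub_cancel]
      rcases hcase with e | e | ⟨h1, h2⟩
      · left
        subst e
        rw [(symAt_spec (hp k hk).1).2, (hp k hk).2]
      · right; right
        subst e
        rw [(symAt_spec (hq k hk).1).2, (hq k hk).2]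
      · right; left
        have hj : i - p k - 1 < ns k := by simp only [hns]; omega
        refine ⟨i - p k - 1, hj, ?_⟩
        have e : p k + 1 + (i - p k - 1) = i := by omega
        have h3 := (hsycont k (by omega) _ hj).1
        rw [e] at h3
        rw [(symAt_spec h3).2]
        simp only [hof, e]
        congr 1; ring
    · rintro ⟨L, hL, hx⟩
      obtain ⟨k, hk, rfl⟩ := List.mem_map.1 hL
      exact (hblk k (List.mem_range.1 hk) x hx).1
end
end

section
/- For every n ∈ ℕ and every w ∈ L(C,n) in canonical block form with block sizes n₁, …, n_N, the block sizes are non-decreasing: n_i ≤ n_{i+1} for every i ∈ {1,…,N−1}. -/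
open scoped NNRat

noncomputable section

theorem flatten_range_split {α : Type} (f : ℕ → List α) (N i : ℕ) (hi : i < N) :
    ∃ pre post, ((List.range N).map f).flatten = pre ++ (f i ++ post) := by
  obtain ⟨k, rfl⟩ : ∃ k, N = i + 1 + k := ⟨N - (i + 1), by omega⟩
  rw [List.range_add, List.range_succ]
  simp only [List.map_append, List.flatten_append, List.map_cons, List.map_nil,
    List.flatten_cons, List.flatten_nil, List.append_nil, List.append_assoc]
  exact ⟨_, _, rfl⟩

/-- Every content position of a block has a content symbol two time units later. -/
theorem content_two_later {S M : Type} (w : List (CMSym S M × ℝ)) (hc : CopyPolicy w)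
    (a b : ℕ) (s : S) (l : CMLabel M)
    (ha : symAt w a = some (CMSym.state s)) (hb : symAt w b = some (CMSym.lab l))
    (hab : a < b) (ht : tAt w b = tAt w a + 1)
    (hcont : ∀ p, a < p → p < b → ∃ σ, symAt w p = some σ ∧ σ.isContent)
    (p : ℕ) (hp : a < p) (hpb : p < b) :
    ∃ σ, σ.isContent ∧ hasAt w σ (tAt w p + 2) := by
  have h := hc a b s l ha hb hab ht
  obtain ⟨σ, hσ, hσc⟩ := hcont p hp hpb
  cases l with
  | eps => exact ⟨CMSym.hash, trivial, h.2 p hp hpb⟩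
  | send m =>
    by_cases hx : ∃ j, a < j ∧ j < b ∧ symAt w j = some CMSym.hash
    · obtain ⟨j, -, -, -, -, h1, h2⟩ := h.1 hx
      by_cases hj : p = j
      · subst hj
        exact ⟨CMSym.msg m, trivial, h1⟩
      · exact ⟨σ, hσc, h2 p σ hp hpb hj hσ⟩
    · have h3 := h.2 (fun j h1 h2 h3 => hx ⟨j, h1, h2, h3⟩)
      exact ⟨σ, hσc, h3.1 p σ hp hpb hσ⟩
  | recv m =>
    by_cases hx : a + 1 < b ∧ symAt w (a + 1) = some (CMSym.msg m)
    · obtain ⟨h1, h2⟩ := h.1 hx.1 hx.2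
      by_cases hl : p = b - 1
      · subst hl
        exact ⟨CMSym.hash, trivial, h2⟩
      · obtain ⟨σ', hσ', hσc'⟩ := hcont (p + 1) (by omega) (by omega)
        have := h1 (p + 1) σ' (by omega) (by omega) hσ'
        exact ⟨σ', hσc', by simpa using this⟩
    · exact ⟨σ, hσc, (h.2 hx).1 p σ hp hpb hσ⟩

theorem hasAt_mem {S M : Type} (w : List (CMSym S M × ℝ)) (σ : CMSym S M) (t : ℝ)
    (h : hasAt w σ t) : (σ, t) ∈ w := by
  obtain ⟨j, hj, h1, h2⟩ := h
  simp only [symAt, tAt, List.getElem?_eq_getElem hj, Option.map_some, Option.some.injEq,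
    Option.getD_some] at h1 h2
  rw [← h1, ← h2]
  exact List.getElem_mem hj

/-- A content event of `w` lies inside one of the blocks. -/
theorem content_in_block {S M : Type} {C : ChannelMachine S M} {sF : S}
    {w : List (CMSym S M × ℝ)} (bf : BlockForm C sF w) (σ : CMSym S M) (t : ℝ)
    (hσ : σ.isContent) (h : (σ, t) ∈ w) :
    ∃ i < bf.N, ∃ j < bf.nsz i, t = bf.δ + 2 * (i : ℝ) + bf.offs i j := by
  rw [bf.eq] at h
  simp only [List.mem_flatten, List.mem_map, List.mem_range] at h
  obtain ⟨_, ⟨i, hi, rfl⟩, h⟩ := h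
  simp only [List.mem_cons, List.mem_append, List.mem_map, List.mem_range, Prod.mk.injEq,
    List.not_mem_nil, or_false] at h
  rcases h with ⟨rfl, -⟩ | ⟨j, hj, -, rfl⟩ | ⟨rfl, -⟩
  · exact hσ.elim
  · exact ⟨i, hi, j, hj, rfl⟩
  · split_ifs at hσ <;> exact hσ.elim

/-- For `w ∈ L(C,n)` in canonical block form, the block sizes are
non-decreasing: `n_i ≤ n_{i+1}`. -/
theorem blockForm_sizes_nondecreasing
    {S M : Type} [Fintype S] [DecidableEq S] [Fintype M] [DecidableEq M]
    (C : ChannelMachine S M) (sF : S) (n : ℕ)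
    (w : List (CMSym S M × ℝ)) (hw : w ∈ CMLang C sF n)
    (bf : BlockForm C sF w) (hn : bf.nsz 0 = n) :
    ∀ i, i + 1 < bf.N → bf.nsz i ≤ bf.nsz (i + 1) := by

  intro i hi
  obtain ⟨-, -, -, -, -, -, -, -, -, -, -, -, -, hc⟩ := hw
  obtain ⟨pre, post, hsplit⟩ := flatten_range_split (fun i =>
      (CMSym.state (bf.states i), bf.δ + 2 * (i : ℝ)) ::
        (((List.range (bf.nsz i)).map fun j =>
            (bf.syms i j, bf.δ + 2 * (i : ℝ) + bf.offs i j)) ++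
          [(if i = bf.N - 1 then CMSym.star else CMSym.lab (bf.labs i),
            bf.δ + 2 * (i : ℝ) + 1)])) bf.N i (by omega)
  have hw' := bf.eq.trans hsplit
  have hne : i ≠ bf.N - 1 := by omega
  simp only [if_neg hne] at hw'
  have h0 : w[pre.length]? = some (CMSym.state (bf.states i), bf.δ + 2 * (i : ℝ)) := by
    refine (congrArg (fun v : List (CMSym S M × ℝ) => v[pre.length]?) hw').trans ?_
    simp
  have h1 : ∀ j < bf.nsz i, w[pre.length + 1 + j]? =
      some (bf.syms i j, bf.δ + 2 * (i : ℝ) + bf.offs i j) := by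
    intro j hj
    refine (congrArg (fun v : List (CMSym S M × ℝ) => v[pre.length + 1 + j]?) hw').trans ?_
    beta_reduce
    rw [List.getElem?_append_right (by omega),
      show pre.length + 1 + j - pre.length = j + 1 by omega, List.cons_append,
      List.getElem?_cons_succ, List.append_assoc,
      List.getElem?_append_left (by simpa using hj)]
    simp [hj]
  have h2 : w[pre.length + 1 + bf.nsz i]? =
      some (CMSym.lab (bf.labs i), bf.δ + 2 * (i : ℝ) + 1) := by
    refine (congrArg (fun v : List (CMSym S M × ℝ) => v[pre.length + 1 + bf.nsz i]?) hw').trans ?_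
    beta_reduce
    rw [List.getElem?_append_right (by omega),
      show pre.length + 1 + bf.nsz i - pre.length = bf.nsz i + 1 by omega, List.cons_append,
      List.getElem?_cons_succ, List.append_assoc,
      List.getElem?_append_right (by simp)]
    simp
  have key : ∀ j : Fin (bf.nsz i), ∃ k : Fin (bf.nsz (i + 1)),
      bf.offs i j = bf.offs (i + 1) k := by
    intro ⟨j, hj⟩
    obtain ⟨σ, hσ, hat⟩ := content_two_later w hc pre.length (pre.length + 1 + bf.nsz i)
      (bf.states i) (bf.labs i) (by simp [symAt, h0]) (by simp [symAt, h2]) (by omega)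
      (by simp [tAt, h0, h2])
      (by
        intro p hp1 hp2
        obtain ⟨q, rfl⟩ : ∃ q, p = pre.length + 1 + q := ⟨p - (pre.length + 1), by omega⟩
        have hq : q < bf.nsz i := by omega
        exact ⟨bf.syms i q, by simp [symAt, h1 q hq], bf.syms_content i (by omega) q hq⟩)
      (pre.length + 1 + j) (by omega) (by omega)
    obtain ⟨i', hi', k, hk, he⟩ := content_in_block bf σ _ hσ (hasAt_mem w σ _ hat)
    have htt : tAt w (pre.length + 1 + j) = bf.δ + 2 * (i : ℝ) + bf.offs i j := by
      simp [tAt, h1 j hj]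
    rw [htt] at he
    have p1 := bf.offs_pos i (by omega) j hj
    have p2 := bf.offs_lt_one i (by omega) j hj
    have p3 := bf.offs_pos i' hi' k hk
    have p4 := bf.offs_lt_one i' hi' k hk
    have q1 : (i' : ℝ) < ((i + 2 : ℕ) : ℝ) := by push_cast; linarith
    have q2 : (i : ℝ) < (i' : ℝ) := by linarith
    have q1' : i' < i + 2 := by exact_mod_cast q1
    have q2' : i < i' := by exact_mod_cast q2
    obtain rfl : i' = i + 1 := by omega
    refine ⟨⟨k, hk⟩, ?_⟩
    push_cast at he
    show bf.offs i j = bf.offs (i + 1) k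
    linarith
  choose g hg using key
  have hinj : Function.Injective g := by
    intro x y hxy
    have hxy' : bf.offs i x = bf.offs i y := by rw [hg x, hg y, hxy]
    rcases lt_trichotomy x.1 y.1 with h | h | h
    · exact absurd hxy' (ne_of_lt (bf.offs_mono i (by omega) _ _ h y.2))
    · exact Fin.ext h
    · exact absurd hxy' (ne_of_gt (bf.offs_mono i (by omega) _ _ h x.2))
  simpa using Fintype.card_le_of_injective g hinj
end
end

section
/- Let n ∈ ℕ, let ν be a parameter valuation, and let w ∈ L(C,n) ∩ L_ν(A_C) with canonical block form having fractional offsets δ^1_1 < … < δ^1_n in the first block and δ′_1 < … < δ′_m in the last block. Then δ^1_i = i/(n+1) for every i ∈ {1,…,n}, ν(p) = 1/(n+1), m = n, δ′_i = δ^1_i for every i, and max(w) = n. -/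
open scoped NNRat

noncomputable section

/-! ### Auxiliary lemmas for the proof -/

lemma aux_split {α : Type} (f : ℕ → List α) (N i : ℕ) (hi : i < N) (j : ℕ) (hj : j < (f i).length) :
    (((List.range N).map f).flatten)[(((List.range i).map f).flatten).length + j]? = (f i)[j]? := by
  induction N with
  | zero => omega
  | succ N ih =>
    rw [List.range_succ, List.map_append, List.flatten_append]
    rcases Nat.lt_succ_iff_lt_or_eq.mp hi with h | h
    · have h1 := ih h
      have h2 : (((List.range i).map f).flatten).length + j
          < (((List.range N).map f).flatten).length := by
        rw [List.getElem?_eq_getElem hj] at h1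
        exact (List.getElem?_eq_some_iff.mp h1).1
      rw [List.getElem?_append_left h2, h1]
    · subst h
      rw [List.getElem?_append_right (by omega)]
      simp

lemma aux_cover {α : Type} (f : ℕ → List α) (N k : ℕ)
    (hk : k < (((List.range N).map f).flatten).length) :
    ∃ i < N, ∃ j < (f i).length, k = (((List.range i).map f).flatten).length + j := by
  induction N with
  | zero => simp at hk
  | succ N ih =>
    by_cases h : k < (((List.range N).map f).flatten).length
    · obtain ⟨i, hi, j, hj, e⟩ := ih h
      exact ⟨i, by omega, j, hj, e⟩
    · refine ⟨N, by omega, k - (((List.range N).map f).flatten).length, ?_, by omega⟩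
      rw [List.range_succ, List.map_append, List.flatten_append, List.length_append] at hk
      simp only [List.map_cons, List.map_nil, List.flatten_cons, List.flatten_nil,
        List.append_nil] at hk
      omega

lemma aux_guard (ν : Unit → ℚ≥0) (v : Unit → ℝ) (h : ClockConstraint.Sat v ν guardEqP) :
    v () = ((ν () : ℚ≥0) : ℝ) := by
  have := h ⟨(), Cmp.eq, Sum.inr ()⟩ (by simp [guardEqP])
  simpa [ClockAtom.Sat, Cmp.holds] using this

lemma aux_block {S M : Type} (C : ChannelMachine S M) (sF : S) (ν : Unit → ℚ≥0)
    (loc : Fin 5) (hloc : loc = 1 ∨ loc = 3) (L : List (CMSym S M × ℝ)) :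
    ∀ (v : Unit → ℝ) (t te : ℝ) (x : CMSym S M) (rest : List (CMSym S M × ℝ)),
    v () = 0 → (∀ e ∈ L, e.1.isContent) → ¬ x.isContent →
    PTA.Run (AC C sF) ν loc v t (L ++ (x, te) :: rest) →
    (∀ j (h : j < L.length), L[j].2 = t + ((j : ℝ) + 1) * ((ν () : ℚ≥0) : ℝ)) ∧
    te = t + ((L.length : ℝ) + 1) * ((ν () : ℚ≥0) : ℝ) ∧
    ((loc = 1 ∧ ∃ l, x = CMSym.lab l) ∨ (loc = 3 ∧ x = CMSym.star)) ∧
    ∃ v' : Unit → ℝ, PTA.Run (AC C sF) ν (loc + 1) v' te rest := by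
  induction L with
  | nil =>
    intro v t te x rest hv hL hx hr
    cases hr with
    | cons φ lam ht he hs hv' hr' =>
      rcases hloc with rfl | rfl
      · simp [AC] at he
        rcases he with ⟨rfl, -⟩ | ⟨⟨l, rfl⟩, rfl, rfl, rfl⟩
        · simp [CMSym.isContent] at hx
        · have := aux_guard _ _ hs
          refine ⟨by simp, by simp; linarith, Or.inl ⟨rfl, l, rfl⟩, _, hr'⟩
      · simp [AC] at he
        rcases he with ⟨h, -⟩ | ⟨rfl, rfl, rfl, rfl⟩
        · exact absurd h hx
        · have := aux_guard _ _ hs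
          refine ⟨by simp, by simp; linarith, Or.inr ⟨rfl, rfl⟩, _, hr'⟩
  | cons e L ih =>
    intro v t te x rest hv hL hx hr
    obtain ⟨σ, t1⟩ := e
    have hσ : σ.isContent := hL (σ, t1) (by simp)
    rw [List.cons_append] at hr
    cases hr with
    | @cons _ _ _ _ _ l' ν' _ φ lam ht he hs hv' hr' =>
      have key : φ = guardEqP ∧ lam = Set.univ ∧ l' = loc := by
        rcases hloc with rfl | rfl
        · simp [AC] at he
          rcases he with ⟨-, h⟩ | ⟨⟨l, rfl⟩, -⟩
          · exact h
          · simp [CMSym.isContent] at hσ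
        · simp [AC] at he
          rcases he with ⟨-, h⟩ | ⟨rfl, -⟩
          · exact h
          · simp [CMSym.isContent] at hσ
      obtain ⟨rfl, rfl, rfl⟩ := key
      have hg := aux_guard _ _ hs
      have hz := (hv' ()).1 trivial
      obtain ⟨h1, h2, h3, h4⟩ := ih ν' t1 te x rest hz
        (fun e he => hL e (List.mem_cons_of_mem _ he)) hx hr'
      simp only [hv] at hg
      refine ⟨?_, ?_, h3, h4⟩
      · intro j hj
        cases j with
        | zero => simp; linarith
        | succ j =>
          have := h1 j (by simpa using hj)
          simp only [List.getElem_cons_succ]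
          rw [this]; push_cast; linarith
      · rw [h2]; simp only [List.length_cons]; push_cast; linarith

lemma aux_run3 {S M : Type} (C : ChannelMachine S M) (sF s : S) (ν : Unit → ℚ≥0)
    (U : List (CMSym S M × ℝ)) : ∀ (v : Unit → ℝ) (t τ : ℝ) (V : List (CMSym S M × ℝ)),
    (∀ e ∈ U, e.1 ≠ CMSym.star) →
    PTA.Run (AC C sF) ν 3 v t (U ++ (CMSym.state s, τ) :: V) → False := by
  induction U with
  | nil =>
    intro v t τ V hU hr
    cases hr with
    | cons φ lam ht he hs hv' hr' => simp [AC, CMSym.isContent] at he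
  | cons e U ih =>
    intro v t τ V hU hr
    obtain ⟨σ, t1⟩ := e
    have hσ : σ ≠ CMSym.star := hU (σ, t1) (by simp)
    rw [List.cons_append] at hr
    cases hr with
    | cons φ lam ht he hs hv' hr' =>
      simp [AC, hσ] at he
      obtain ⟨-, -, -, rfl⟩ := he
      exact ih _ _ _ _ (fun e he => hU e (List.mem_cons_of_mem _ he)) hr'

lemma aux_run2 {S M : Type} (C : ChannelMachine S M) (sF : S) (ν : Unit → ℚ≥0)
    (U : List (CMSym S M × ℝ)) : ∀ (v : Unit → ℝ) (t τ : ℝ) (V : List (CMSym S M × ℝ)),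
    (∀ e ∈ U, e.1 ≠ CMSym.star) →
    PTA.Run (AC C sF) ν 2 v t (U ++ (CMSym.state sF, τ) :: V) →
    ∃ v' : Unit → ℝ, v' () = 0 ∧ PTA.Run (AC C sF) ν 3 v' τ V := by
  induction U with
  | nil =>
    intro v t τ V hU hr
    cases hr with
    | cons φ lam ht he hs hv' hr' =>
      simp [AC] at he
      obtain ⟨-, rfl, rfl⟩ := he
      exact ⟨_, (hv' ()).1 trivial, hr'⟩
  | cons e U ih =>
    intro v t τ V hU hr
    obtain ⟨σ, t1⟩ := e
    rw [List.cons_append] at hr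
    have hU' := fun e he => hU e (List.mem_cons_of_mem _ he)
    cases hr with
    | cons φ lam ht he hs hv' hr' =>
      simp [AC] at he
      rcases he with ⟨-, -, -, rfl⟩ | ⟨-, -, -, rfl⟩
      · exact ih _ _ _ _ hU' hr'
      · exact (aux_run3 C sF sF ν U _ _ _ _ hU' hr').elim

/-- The `i`-th block (with state and closing symbol) of a canonical block form. -/
def auxBlk {S M : Type} {C : ChannelMachine S M} {sF : S} {w : List (CMSym S M × ℝ)}
    (bf : BlockForm C sF w) (i : ℕ) : List (CMSym S M × ℝ) :=
  (CMSym.state (bf.states i), bf.δ + 2 * (i : ℝ)) ::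
    (((List.range (bf.nsz i)).map fun j => (bf.syms i j, bf.δ + 2 * (i : ℝ) + bf.offs i j)) ++
      [(if i = bf.N - 1 then CMSym.star else CMSym.lab (bf.labs i), bf.δ + 2 * (i : ℝ) + 1)])

/-- The position of the state symbol of block `i`. -/
def auxPos {S M : Type} {C : ChannelMachine S M} {sF : S} {w : List (CMSym S M × ℝ)}
    (bf : BlockForm C sF w) (i : ℕ) : ℕ := (((List.range i).map (auxBlk bf)).flatten).length

section
variable {S M : Type} {C : ChannelMachine S M} {sF : S} {w : List (CMSym S M × ℝ)}
  (bf : BlockForm C sF w)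

lemma auxBlk_length (i : ℕ) : (auxBlk bf i).length = bf.nsz i + 2 := by
  simp [auxBlk]

lemma aux_w : w = ((List.range bf.N).map (auxBlk bf)).flatten := bf.eq

lemma aux_get (i j : ℕ) (hi : i < bf.N) (hj : j < bf.nsz i + 2) :
    w[auxPos bf i + j]? = (auxBlk bf i)[j]? := by
  refine (congrArg (fun u => u[auxPos bf i + j]?) (aux_w bf)).trans ?_
  exact aux_split (auxBlk bf) bf.N i hi j (by rw [auxBlk_length]; exact hj)

lemma aux_get_state (i : ℕ) (hi : i < bf.N) :
    w[auxPos bf i]? = some (CMSym.state (bf.states i), bf.δ + 2 * (i : ℝ)) := by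
  have := aux_get bf i 0 hi (by omega)
  simpa [auxBlk] using this

lemma aux_get_content (i j : ℕ) (hi : i < bf.N) (hj : j < bf.nsz i) :
    w[auxPos bf i + 1 + j]? = some (bf.syms i j, bf.δ + 2 * (i : ℝ) + bf.offs i j) := by
  have := aux_get bf i (j + 1) hi (by omega)
  rw [show auxPos bf i + 1 + j = auxPos bf i + (j + 1) by omega, this]
  simp [auxBlk, List.getElem?_append_left, hj]

lemma aux_get_end (i : ℕ) (hi : i < bf.N) :
    w[auxPos bf i + 1 + bf.nsz i]? =
      some (if i = bf.N - 1 then CMSym.star else CMSym.lab (bf.labs i),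
        bf.δ + 2 * (i : ℝ) + 1) := by
  have := aux_get bf i (bf.nsz i + 1) hi (by omega)
  rw [show auxPos bf i + 1 + bf.nsz i = auxPos bf i + (bf.nsz i + 1) by omega, this]
  simp [auxBlk, List.getElem?_append_right]

lemma aux_cases (k : ℕ) (hk : k < w.length) : ∃ i < bf.N, k = auxPos bf i ∨
    (∃ j < bf.nsz i, k = auxPos bf i + 1 + j) ∨ k = auxPos bf i + 1 + bf.nsz i := by
  rw [aux_w bf] at hk
  obtain ⟨i, hi, j, hj, e⟩ := aux_cover _ _ _ hk
  rw [auxBlk_length] at hj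
  refine ⟨i, hi, ?_⟩
  change k = auxPos bf i + j at e
  rcases Nat.eq_zero_or_pos j with h | h
  · left; omega
  · right
    by_cases h' : j < bf.nsz i + 1
    · left; exact ⟨j - 1, by omega, by omega⟩
    · right; omega

lemma aux_hasAt (i : ℕ) (hi : i < bf.N) (o : ℝ) (h0 : 0 < o) (h1 : o < 1) (σ : CMSym S M)
    (h : hasAt w σ (bf.δ + 2 * (i : ℝ) + o)) : ∃ j < bf.nsz i, bf.offs i j = o := by
  obtain ⟨k, hk, -, ht⟩ := h
  have arith : ∀ (i' : ℕ) (x : ℝ), 0 ≤ x → x ≤ 1 →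
      bf.δ + 2 * (i' : ℝ) + x = bf.δ + 2 * (i : ℝ) + o → i' = i ∧ x = o := by
    intro i' x hx0 hx1 he
    have e1 : i' < i + 1 := by
      have : (i' : ℝ) < (i : ℝ) + 1 := by linarith
      exact_mod_cast this
    have e2 : i < i' + 1 := by
      have : (i : ℝ) < (i' : ℝ) + 1 := by linarith
      exact_mod_cast this
    have : i' = i := by omega
    subst this
    exact ⟨rfl, by linarith⟩
  obtain ⟨i', hi', e | ⟨j, hj, e⟩ | e⟩ := aux_cases bf k hk
  · simp [tAt, e, aux_get_state bf i' hi'] at ht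
    have := arith i' 0 (by simp) (by simp) (by linarith)
    linarith [this.2]
  · simp only [tAt, e, aux_get_content bf i' j hi' hj, Option.map_some, Option.getD_some] at ht
    obtain ⟨rfl, h⟩ := arith i' _ (bf.offs_pos i' hi' j hj).le (bf.offs_lt_one i' hi' j hj).le ht
    exact ⟨j, hj, h⟩
  · simp only [tAt, e, aux_get_end bf i' hi', Option.map_some, Option.getD_some] at ht
    have := arith i' 1 (by simp) le_rfl ht
    linarith [this.2]

/-- The copy policy places some symbol two time units after each content symbol. -/
lemma aux_copy (hc : CopyPolicy w) (a b : ℕ) (s : S) (l : CMLabel M)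
    (ha : symAt w a = some (CMSym.state s)) (hb : symAt w b = some (CMSym.lab l))
    (hab : a < b) (ht : tAt w b = tAt w a + 1) (i : ℕ) (hai : a < i) (hib : i < b) :
    ∃ σ, hasAt w σ (tAt w i + 2) := by
  have h := hc a b s l ha hb hab ht
  have hlen : b < w.length := by
    by_contra hh
    simp [symAt, List.getElem?_eq_none (not_lt.mp hh)] at hb
  have hsym : ∀ k, k < b → ∃ σ, symAt w k = some σ := by
    intro k hk
    exact ⟨w[k].1, by simp [symAt, List.getElem?_eq_getElem (hk.trans hlen)]⟩
  obtain ⟨σ, hσ⟩ := hsym i hib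
  cases l with
  | eps => exact ⟨_, h.2 i hai hib⟩
  | send m =>
    simp only at h
    by_cases hh : ∃ j, a < j ∧ j < b ∧ symAt w j = some CMSym.hash
    · obtain ⟨j, h1, h2, h3, h4, h5, h6⟩ := h.1 hh
      by_cases hij : i = j
      · subst hij; exact ⟨_, h5⟩
      · exact ⟨_, h6 i σ hai hib hij hσ⟩
    · have := h.2 (fun j h1 h2 h3 => hh ⟨j, h1, h2, h3⟩)
      exact ⟨_, this.1 i σ hai hib hσ⟩
  | recv m =>
    simp only at h
    by_cases hh : a + 1 < b ∧ symAt w (a + 1) = some (CMSym.msg m)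
    · obtain ⟨h1, h2⟩ := h.1 hh.1 hh.2
      by_cases hi : i = b - 1
      · subst hi; exact ⟨_, h2⟩
      · obtain ⟨σ', hσ'⟩ := hsym (i + 1) (by omega)
        exact ⟨_, by simpa using h1 (i + 1) σ' (by omega) (by omega) hσ'⟩
    · exact ⟨_, (h.2 hh).1 i σ hai hib hσ⟩

lemma aux_nsz_step (hc : CopyPolicy w) (i : ℕ) (hi : i + 1 < bf.N) :
    bf.nsz i ≤ bf.nsz (i + 1) := by
  have hi' : i < bf.N := by omega
  have key : ∀ j : Fin (bf.nsz i), ∃ k : Fin (bf.nsz (i + 1)), bf.offs (i + 1) k = bf.offs i j := by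
    intro ⟨j, hj⟩
    have he := aux_get_end bf i hi'
    rw [if_neg (by omega)] at he
    have hs := aux_get_state bf i hi'
    have hcj := aux_get_content bf i j hi' hj
    obtain ⟨σ, hσ⟩ := aux_copy hc (auxPos bf i) (auxPos bf i + 1 + bf.nsz i) (bf.states i)
      (bf.labs i) (by simp [symAt, hs]) (by simp [symAt, he]) (by omega)
      (by simp [tAt, hs, he]) (auxPos bf i + 1 + j) (by omega) (by omega)
    have e : tAt w (auxPos bf i + 1 + j) + 2
        = bf.δ + 2 * ((i + 1 : ℕ) : ℝ) + bf.offs i j := by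
      simp only [tAt, hcj, Option.map_some, Option.getD_some]; push_cast; ring
    rw [e] at hσ
    obtain ⟨k, hk, h⟩ := aux_hasAt bf (i + 1) hi _ (bf.offs_pos i hi' j hj)
      (bf.offs_lt_one i hi' j hj) σ hσ
    exact ⟨⟨k, hk⟩, h⟩
  choose f hf using key
  have hinj : Function.Injective f := by
    intro x y hxy
    have h : bf.offs i x = bf.offs i y := by rw [← hf x, ← hf y, hxy]
    rcases lt_trichotomy x y with hlt | heq | hlt
    · exact absurd h (bf.offs_mono i hi' x y hlt y.2).ne
    · exact heq
    · exact absurd h (bf.offs_mono i hi' y x hlt x.2).ne'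
  simpa using Fintype.card_le_of_injective f hinj

lemma aux_nsz_le (hc : CopyPolicy w) (d : ℕ) : ∀ i, i + d < bf.N →
    bf.nsz i ≤ bf.nsz (i + d) := by
  induction d with
  | zero => intro i _; exact le_rfl
  | succ d ih => intro i hi; exact (ih i (by omega)).trans (aux_nsz_step bf hc (i + d) hi)

lemma aux_wordMax (hc : CopyPolicy w) (h0 : bf.nsz 0 = bf.nsz (bf.N - 1)) :
    wordMax w = bf.nsz 0 := by
  have hN := bf.Npos
  apply IsGreatest.csSup_eq
  constructor
  · have hs := aux_get_state bf 0 hN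
    have he := aux_get_end bf 0 hN
    refine ⟨auxPos bf 0, auxPos bf 0 + 1 + bf.nsz 0, by omega,
      (List.getElem?_eq_some_iff.mp he).1, ⟨bf.states 0, by simp [symAt, hs]⟩,
      ⟨_, by rw [symAt, he]; rfl, ?_⟩, ?_, by omega⟩
    · dsimp only
      split_ifs <;> simp [CMSym.isLabOrStar]
    · intro i h1 h2
      obtain ⟨j, rfl⟩ : ∃ j, i = auxPos bf 0 + 1 + j := ⟨i - auxPos bf 0 - 1, by omega⟩
      have hj : j < bf.nsz 0 := by omega
      exact ⟨_, by rw [symAt, aux_get_content bf 0 j hN hj]; rfl, bf.syms_content 0 hN j hj⟩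
  · rintro k ⟨a, b, hab, hb, ⟨s, hs⟩, ⟨σ, hσ, hlab⟩, hcont, rfl⟩
    obtain ⟨i, hi, e | ⟨j, hj, e⟩ | e⟩ := aux_cases bf a (by omega)
    · have hend : b = auxPos bf i + 1 + bf.nsz i := by
        rcases lt_trichotomy b (auxPos bf i + 1 + bf.nsz i) with h | h | h
        · exfalso
          obtain ⟨j, rfl⟩ : ∃ j, b = auxPos bf i + 1 + j := ⟨b - auxPos bf i - 1, by omega⟩
          have hj : j < bf.nsz i := by omega
          have := bf.syms_content i hi j hj
          rw [symAt, aux_get_content bf i j hi hj] at hσ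
          simp only [Option.map_some, Option.some.injEq] at hσ
          rw [hσ] at this
          cases σ <;> simp [CMSym.isContent, CMSym.isLabOrStar] at this hlab
        · exact h
        · exfalso
          obtain ⟨τ, h1, h2⟩ := hcont _ (by omega) h
          rw [symAt, aux_get_end bf i hi] at h1
          simp only [Option.map_some, Option.some.injEq] at h1
          subst h1
          split_ifs at h2 <;> simp [CMSym.isContent] at h2
      have h3 := aux_nsz_le bf hc (bf.N - 1 - i) i (by omega)
      rw [show i + (bf.N - 1 - i) = bf.N - 1 by omega, ← h0] at h3
      omega
    · exfalso
      have := bf.syms_content i hi j hj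
      rw [symAt, e, aux_get_content bf i j hi hj] at hs
      simp only [Option.map_some, Option.some.injEq] at hs
      rw [hs] at this
      simp [CMSym.isContent] at this
    · exfalso
      rw [symAt, e, aux_get_end bf i hi] at hs
      simp only [Option.map_some, Option.some.injEq] at hs
      split_ifs at hs

lemma aux_inner_content (i : ℕ) (hi : i < bf.N) :
    ∀ e ∈ (List.range (bf.nsz i)).map
      (fun j => (bf.syms i j, bf.δ + 2 * (i : ℝ) + bf.offs i j)), e.1.isContent := by
  intro e he
  simp only [List.mem_map, List.mem_range] at he
  obtain ⟨j, hj, rfl⟩ := he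
  exact bf.syms_content i hi j hj

/-- Consequences of acceptance by `A_C`. -/
lemma aux_accept (ν : Unit → ℚ≥0) (hacc : w ∈ (AC C sF).Lang ν) :
    (∀ j < bf.nsz 0, bf.offs 0 j = ((j : ℝ) + 1) * ((ν () : ℚ≥0) : ℝ)) ∧
    1 = ((bf.nsz 0 : ℝ) + 1) * ((ν () : ℚ≥0) : ℝ) ∧
    (∀ j < bf.nsz (bf.N - 1), bf.offs (bf.N - 1) j = ((j : ℝ) + 1) * ((ν () : ℚ≥0) : ℝ)) ∧
    1 = ((bf.nsz (bf.N - 1) : ℝ) + 1) * ((ν () : ℚ≥0) : ℝ) := by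
  obtain ⟨-, l0, hl0, hr⟩ := hacc
  have hl0' : l0 = 0 := by simpa [AC] using hl0
  subst hl0'
  have hN := bf.Npos
  obtain ⟨K, hK⟩ : ∃ K, bf.N = K + 1 := ⟨bf.N - 1, by omega⟩
  have hw := aux_w bf
  have nc : ∀ i, ¬ (if i = bf.N - 1 then CMSym.star else CMSym.lab (bf.labs i) :
      CMSym S M).isContent := by
    intro i; split_ifs <;> simp [CMSym.isContent]
  have hw1 : w = auxBlk bf 0 ++ (((List.range K).map (fun i => auxBlk bf (i + 1)))).flatten := by
    refine hw.trans ?_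
    rw [hK, List.range_succ_eq_map]
    simp [List.map_map, Function.comp_def]
  have hr1 := hr
  rw [hw1, auxBlk, List.cons_append, List.append_assoc, List.singleton_append] at hr1
  cases hr1 with
  | cons φ lam ht he hs hv' hr' =>
    simp [AC] at he
    obtain ⟨-, -, rfl, rfl⟩ := he
    obtain ⟨h1, h2, h3, v1, h4⟩ := aux_block C sF ν 1 (Or.inl rfl) _ _ _ _ _ _
      ((hv' ()).1 trivial) (aux_inner_content bf 0 hN) (nc 0) hr'
    have hK0 : K ≠ 0 := by
      rintro rfl
      rcases h3 with ⟨-, l, h⟩ | ⟨h, -⟩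
      · rw [if_pos (by omega)] at h; cases h
      · revert h; decide
    obtain ⟨K', rfl⟩ : ∃ K', K = K' + 1 := ⟨K - 1, by omega⟩
    have hlast : bf.N - 1 = K' + 1 := by omega
    rw [List.range_succ, List.map_append, List.flatten_append] at h4
    simp only [List.map_cons, List.map_nil, List.flatten_cons, List.flatten_nil,
      List.append_nil] at h4
    have hsF : bf.states (K' + 1) = sF := by rw [← hlast]; exact bf.last
    rw [show auxBlk bf (K' + 1) = _ from rfl, auxBlk, hsF] at h4
    obtain ⟨v2, hv2, h5⟩ := aux_run2 C sF ν _ _ _ _ _ (by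
      intro e he
      simp only [List.mem_flatten, List.mem_map, List.mem_range] at he
      obtain ⟨_, ⟨i, hi, rfl⟩, he⟩ := he
      simp only [auxBlk, List.mem_cons, List.mem_append, List.not_mem_nil, or_false] at he
      rcases he with rfl | he | rfl
      · simp
      · have := aux_inner_content bf (i + 1) (by omega) e he
        intro h; rw [h] at this; simp [CMSym.isContent] at this
      · rw [if_neg (by omega)]; simp) h4
    obtain ⟨g1, g2, -⟩ := aux_block C sF ν 3 (Or.inr rfl) _ _ _ _ _ _ hv2
      (aux_inner_content bf (K' + 1) (by omega)) (nc (K' + 1)) h5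
    rw [hlast]
    simp only [List.length_map, List.length_range, List.getElem_map, List.getElem_range]
      at h1 h2 g1 g2
    refine ⟨fun j hj => ?_, by linarith, fun j hj => ?_, by linarith⟩
    · have := h1 j hj; linarith
    · have := g1 j hj; linarith

end

/-- Let `w ∈ L(C,n) ∩ L_ν(A_C)` with canonical block form. Then the
offsets of the first block are `δ^1_i = i/(n+1)`, `ν(p) = 1/(n+1)`, the last block has
exactly `n` content symbols with the same offsets as the first block, and `max(w) = n`. -/
theorem accepted_word_offsets
    {S M : Type} [Fintype S] [DecidableEq S] [Fintype M] [DecidableEq M]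
    (C : ChannelMachine S M) (sF : S)
    (n : ℕ) (ν : Unit → ℚ≥0) (w : List (CMSym S M × ℝ))
    (hw : w ∈ CMLang C sF n) (hacc : w ∈ (AC C sF).Lang ν)
    (bf : BlockForm C sF w) (hn : bf.nsz 0 = n) :
    (∀ j < n, bf.offs 0 j = ((j : ℝ) + 1) / ((n : ℝ) + 1)) ∧
    (ν () : ℚ) = 1 / ((n : ℚ) + 1) ∧
    bf.nsz (bf.N - 1) = n ∧
    (∀ j < n, bf.offs (bf.N - 1) j = bf.offs 0 j) ∧
    wordMax w = n := by
  have hc : CopyPolicy w := by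
    obtain ⟨-, -, -, -, -, -, -, -, -, -, -, -, -, h⟩ := hw
    exact h
  obtain ⟨h1, h2, h3, h4⟩ := aux_accept bf ν hacc
  rw [hn] at h1 h2
  have hn0 : (n : ℝ) + 1 ≠ 0 := by positivity
  have hp : ((ν () : ℚ≥0) : ℝ) = 1 / ((n : ℝ) + 1) := by
    field_simp; linarith
  have hpne : ((ν () : ℚ≥0) : ℝ) ≠ 0 := by
    rw [hp]; positivity
  have hm : bf.nsz (bf.N - 1) = n := by
    have := mul_right_cancel₀ hpne (h4.symm.trans h2)
    have : ((bf.nsz (bf.N - 1) : ℕ) : ℝ) = n := by linarith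
    exact_mod_cast this
  refine ⟨fun j hj => ?_, ?_, hm, fun j hj => ?_, ?_⟩
  · rw [h1 j hj, hp]; ring
  · have : (((ν () : ℚ) : ℝ)) = ((1 / ((n : ℚ) + 1) : ℚ) : ℝ) := by
      push_cast; exact hp
    exact_mod_cast this
  · rw [h1 j hj, h3 j (by omega)]
  · rw [aux_wordMax bf hc (by rw [hn, hm]), hn]
end
end
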